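/- Let R = ℂ[x,y,z,w]. For i = 1, 2 let ℓᵢ be a nonzero linear form and qᵢ a quadratic form such that the restriction of qᵢ to the plane {ℓᵢ = 0} is a nondegenerate quadratic form in three variables (so Iᵢ = (ℓᵢ, qᵢ) is the homogeneous ideal of a smooth conic Qᵢ ⊂ P³), and suppose that (x,y,z,w)^N ⊆ I₁ + I₂ for some natural number N (i.e., Q₁ ∩ Q₂ = ∅). Then the ideal I₁ ∩ I₂ is strictly larger than the ideal generated by its homogeneous elements of degree at most 3. (This expresses that for a disjoint union Y of two smooth conics, I_Y(3) is not globally generated: the minimal resolution of I_Y has a generator of degree 4.) -/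

import Mathlib

open MvPolynomial

/-- The restriction of the quadratic form `q` to the plane `{ℓ = 0} ⊆ ℂ⁴` is a
nondegenerate quadratic form (in three variables): its polar bilinear form
`(p, p') ↦ q(p + p') − q(p) − q(p')` is nondegenerate on the plane. -/
def SmoothConic (l q : MvPolynomial (Fin 4) ℂ) : Prop :=
  ∀ p : Fin 4 → ℂ, p ≠ 0 → eval p l = 0 →
    ∃ p' : Fin 4 → ℂ, eval p' l = 0 ∧
      eval (p + p') q - eval p q - eval p' q ≠ 0

noncomputable section

variable {σ K : Type*} [Field K]

/-- Restriction of a polynomial function to the parametrized line `t ↦ u + t • v`. -/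
def lineRestrict (u v : σ → K) : MvPolynomial σ K →ₐ[K] Polynomial K :=
  aeval fun i => Polynomial.C (v i) * Polynomial.X + Polynomial.C (u i)

theorem eval_lineRestrict (u v : σ → K) (t : K) (f : MvPolynomial σ K) :
    (lineRestrict u v f).eval t = eval (u + t • v) f := by
  induction f using MvPolynomial.induction_on with
  | C a => simp [lineRestrict]
  | add p q hp hq => simp [hp, hq]
  | mul_X p i hp =>
    rw [map_mul, Polynomial.eval_mul, hp, map_mul]
    simp [lineRestrict, mul_comm t, add_comm (u i)]

theorem natDegree_prod_pow_le_and_coeff {ι R : Type*} [CommSemiring R] (s : Finset ι)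
    (f : ι → Polynomial R) (hf : ∀ i, (f i).natDegree ≤ 1) (d : ι → ℕ) :
    (∏ i ∈ s, f i ^ d i).natDegree ≤ ∑ i ∈ s, d i ∧
      (∏ i ∈ s, f i ^ d i).coeff (∑ i ∈ s, d i) = ∏ i ∈ s, (f i).coeff 1 ^ d i := by
  classical
  induction s using Finset.induction_on with
  | empty => simp
  | insert i s hi ih =>
    have hpow : (f i ^ d i).natDegree ≤ d i := by
      simpa using Polynomial.natDegree_pow_le_of_le (d i) (hf i)
    have hcoeff := Polynomial.coeff_pow_of_natDegree_le (m := d i) (hf i)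
    rw [mul_one] at hcoeff
    simp only [Finset.prod_insert hi, Finset.sum_insert hi]
    exact ⟨Polynomial.natDegree_mul_le_of_le hpow ih.1, by
      rw [Polynomial.coeff_mul_add_eq_of_natDegree_le hpow ih.1, hcoeff, ih.2]⟩

theorem lineRestrict_natDegree_le_and_coeff [Fintype σ] (u v : σ → K) {f : MvPolynomial σ K}
    {n : ℕ} (hf : f.IsHomogeneous n) :
    (lineRestrict u v f).natDegree ≤ n ∧ (lineRestrict u v f).coeff n = eval v f := by
  have hsum : ∀ d ∈ f.support, ∑ i, d i = n := fun d hd => by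
    rw [← Finsupp.degree_eq_sum, Finsupp.degree_eq_weight_one]
    exact hf (mem_support_iff.mp hd)
  have hlin : ∀ i, (Polynomial.C (v i) * Polynomial.X + Polynomial.C (u i)).natDegree ≤ 1 :=
    fun i => Polynomial.natDegree_linear_le
  rw [lineRestrict, aeval_def, eval₂_eq', eval_eq']
  constructor
  · refine Polynomial.natDegree_sum_le_of_forall_le _ _ fun d hd => ?_
    refine (Polynomial.natDegree_C_mul_le _ _).trans ?_
    rw [← hsum d hd]
    exact (natDegree_prod_pow_le_and_coeff _ _ hlin _).1
  · rw [Polynomial.finsetSum_coeff]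
    refine Finset.sum_congr rfl fun d hd => ?_
    rw [Polynomial.algebraMap_eq, Polynomial.coeff_C_mul, ← hsum d hd,
      (natDegree_prod_pow_le_and_coeff _ _ hlin _).2]
    simp

theorem lineRestrict_natDegree_eq [Fintype σ] (u : σ → K) {v : σ → K} {f : MvPolynomial σ K}
    {n : ℕ} (hf : f.IsHomogeneous n) (hv : eval v f ≠ 0) :
    (lineRestrict u v f).natDegree = n := by
  obtain ⟨hle, hcoeff⟩ := lineRestrict_natDegree_le_and_coeff u v hf
  exact le_antisymm hle (Polynomial.le_natDegree_of_ne_zero (hcoeff ▸ hv))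

theorem exists_linearMap_eval_of_isHomogeneous_one {l : MvPolynomial σ K}
    (hl : l.IsHomogeneous 1) : ∃ L : (σ → K) →ₗ[K] K, ∀ p, L p = eval p l := by
  rw [← mem_homogeneousSubmodule, homogeneousSubmodule_one_eq_span_X] at hl
  induction hl using Submodule.span_induction with
  | mem x hx =>
    obtain ⟨i, rfl⟩ := hx
    exact ⟨LinearMap.proj i, fun p => by simp⟩
  | zero => exact ⟨0, fun p => by simp⟩
  | add x y _ _ hx hy =>
    obtain ⟨L, hL⟩ := hx
    obtain ⟨M, hM⟩ := hy
    exact ⟨L + M, fun p => by simp [hL, hM]⟩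
  | smul a x _ hx =>
    obtain ⟨L, hL⟩ := hx
    exact ⟨a • L, fun p => by simp [hL, smul_eval]⟩

theorem exists_mem_forall_add_smul_ne_zero {V : Type*} [AddCommGroup V] [Module K V]
    {W : Submodule K V} (hW : 2 ≤ Module.finrank K W) (v : V) :
    ∃ u ∈ W, ∀ t : K, u + t • v ≠ 0 := by
  by_contra! h
  have hle : W ≤ Submodule.span K {v} := fun u hu => by
    obtain ⟨t, ht⟩ := h u hu
    exact Submodule.mem_span_singleton.mpr ⟨-t, by rw [neg_smul, ← eq_neg_of_add_eq_zero_left ht]⟩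
  have hmono := Submodule.finrank_mono hle
  have hspan := finrank_span_le_card (R := K) ({v} : Set V)
  simp only [Set.toFinset_singleton, Finset.card_singleton] at hspan
  omega

theorem exists_zero_of_isHomogeneous [Fintype σ] [IsAlgClosed K] {W : Submodule K (σ → K)}
    (hW : 2 ≤ Module.finrank K W) {f : MvPolynomial σ K} {n : ℕ} (hn : n ≠ 0)
    (hf : f.IsHomogeneous n) : ∃ p ∈ W, p ≠ 0 ∧ eval p f = 0 := by
  obtain ⟨v, hv, hv0⟩ := exists_mem_forall_add_smul_ne_zero hW 0
  obtain ⟨u, hu, huv⟩ := exists_mem_forall_add_smul_ne_zero hW v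
  by_cases hfv : eval v f = 0
  · exact ⟨v, hv, by simpa using hv0 0, hfv⟩
  · have hdeg := lineRestrict_natDegree_eq u hf hfv
    obtain ⟨t, ht⟩ := IsAlgClosed.exists_root (lineRestrict u v f) fun h =>
      hn (hdeg ▸ Polynomial.natDegree_eq_of_degree_eq_some h)
    exact ⟨u + t • v, W.add_mem hu (W.smul_mem t hv), huv t, by rw [← eval_lineRestrict]; exact ht⟩

theorem exists_eval_ne_zero_and_eval_ne_zero [Infinite K] {W : Submodule K (σ → K)}
    {f g : MvPolynomial σ K} (hf : ∃ p ∈ W, eval p f ≠ 0) (hg : ∃ p ∈ W, eval p g ≠ 0) :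
    ∃ p ∈ W, eval p f ≠ 0 ∧ eval p g ≠ 0 := by
  obtain ⟨a, ha, hfa⟩ := hf
  obtain ⟨b, hb, hgb⟩ := hg
  have hf0 : lineRestrict a (b - a) f ≠ 0 := fun h => hfa <| by
    simpa [h] using (eval_lineRestrict a (b - a) 0 f).symm
  have hg0 : lineRestrict a (b - a) g ≠ 0 := fun h => hgb <| by
    simpa [h] using (eval_lineRestrict a (b - a) 1 g).symm
  obtain ⟨t, ht⟩ : ∃ t, (lineRestrict a (b - a) f * lineRestrict a (b - a) g).eval t ≠ 0 := by
    by_contra! h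
    exact mul_ne_zero hf0 hg0 (Polynomial.funext fun t => by simpa using h t)
  rw [Polynomial.eval_mul, eval_lineRestrict, eval_lineRestrict] at ht
  exact ⟨_, W.add_mem ha (W.smul_mem t (W.sub_mem hb ha)), left_ne_zero_of_mul ht,
    right_ne_zero_of_mul ht⟩

/-- Along a line on which `l` vanishes, every element of `(l, q)` restricts to a multiple of the
restriction of `q`. -/
theorem lineRestrict_dvd_of_mem_span_pair [Infinite K]
    {W : Submodule K (σ → K)} {l q f : MvPolynomial σ K} (hl : ∀ p ∈ W, eval p l = 0)
    {u v : σ → K} (hu : u ∈ W) (hv : v ∈ W) (hf : f ∈ Ideal.span {l, q}) :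
    lineRestrict u v q ∣ lineRestrict u v f := by
  have hl0 : lineRestrict u v l = 0 := Polynomial.funext fun t => by
    rw [eval_lineRestrict, hl _ (W.add_mem hu (W.smul_mem t hv)), Polynomial.eval_zero]
  obtain ⟨a, b, rfl⟩ := Ideal.mem_span_pair.mp hf
  simp [hl0]

end

theorem eq_zero_of_eval_eq_zero_of_pow_le {I : Ideal (MvPolynomial (Fin 4) ℂ)} {N : ℕ}
    (hI : Ideal.span ({X 0, X 1, X 2, X 3} : Set (MvPolynomial (Fin 4) ℂ)) ^ N ≤ I)
    {p : Fin 4 → ℂ} (hp : I ≤ RingHom.ker (eval p)) : p = 0 := by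
  funext i
  have hX : (X i : MvPolynomial (Fin 4) ℂ) ∈ Ideal.span {X 0, X 1, X 2, X 3} :=
    Ideal.subset_span (by fin_cases i <;> simp)
  have h := hp (hI (Ideal.pow_mem_pow hX N))
  rw [RingHom.mem_ker, map_pow, eval_X] at h
  exact eq_zero_of_pow_eq_zero h

/-- For a disjoint union `Y = Q₁ ∪ Q₂` of two smooth conics in `P³`, with ideals
`I₁ = (ℓ₁, q₁)` and `I₂ = (ℓ₂, q₂)`, the ideal `I₁ ∩ I₂` of `Y` is strictly larger
than the ideal generated by its homogeneous elements of degree at most `3`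
(i.e. `I_Y(3)` is not globally generated). -/
theorem two_disjoint_conics_not_generated_by_cubics
    (l₁ q₁ l₂ q₂ : MvPolynomial (Fin 4) ℂ)
    (hl₁ : l₁.IsHomogeneous 1) (hl₁0 : l₁ ≠ 0) (hq₁ : q₁.IsHomogeneous 2)
    (hsm₁ : SmoothConic l₁ q₁)
    (hl₂ : l₂.IsHomogeneous 1) (hl₂0 : l₂ ≠ 0) (hq₂ : q₂.IsHomogeneous 2)
    (hsm₂ : SmoothConic l₂ q₂)
    (I₁ I₂ : Ideal (MvPolynomial (Fin 4) ℂ))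
    (hI₁ : I₁ = Ideal.span {l₁, q₁}) (hI₂ : I₂ = Ideal.span {l₂, q₂})
    (hdisj : ∃ N : ℕ,
      (Ideal.span ({X 0, X 1, X 2, X 3} : Set (MvPolynomial (Fin 4) ℂ))) ^ N ≤ I₁ + I₂) :
    Ideal.span {f | f ∈ I₁ ⊓ I₂ ∧ ∃ d ≤ 3, f.IsHomogeneous d} < I₁ ⊓ I₂ := by
  subst hI₁ hI₂
  obtain ⟨N, hN⟩ := hdisj
  obtain ⟨L₁, hL₁⟩ := exists_linearMap_eval_of_isHomogeneous_one hl₁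
  obtain ⟨L₂, hL₂⟩ := exists_linearMap_eval_of_isHomogeneous_one hl₂
  let W := LinearMap.ker (L₁.prod L₂)
  have hW : 2 ≤ Module.finrank ℂ W := by
    change 2 ≤ Module.finrank ℂ (LinearMap.ker (L₁.prod L₂))
    have h := (L₁.prod L₂).finrank_range_add_finrank_ker
    have h' := Submodule.finrank_le (LinearMap.range (L₁.prod L₂))
    simp only [Module.finrank_fin_fun, Module.finrank_prod, Module.finrank_self] at h h'
    omega
  have hW₁ : ∀ p ∈ W, eval p l₁ = 0 := fun p hp => by
    rw [← hL₁]; exact congrArg Prod.fst (LinearMap.mem_ker.mp hp)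
  have hW₂ : ∀ p ∈ W, eval p l₂ = 0 := fun p hp => by
    rw [← hL₂]; exact congrArg Prod.snd (LinearMap.mem_ker.mp hp)
  have hzero : ∀ p ∈ W, eval p q₁ = 0 → eval p q₂ = 0 → p = 0 := fun p hp h₁ h₂ => by
    refine eq_zero_of_eval_eq_zero_of_pow_le hN (sup_le ?_ ?_) <;>
      rw [Ideal.span_le, Set.insert_subset_iff, Set.singleton_subset_iff]
    · exact ⟨hW₁ p hp, h₁⟩
    · exact ⟨hW₂ p hp, h₂⟩
  have hne₁ : ∃ p ∈ W, eval p q₁ ≠ 0 := by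
    obtain ⟨p, hp, hp0, hpq⟩ := exists_zero_of_isHomogeneous hW two_ne_zero hq₂
    exact ⟨p, hp, fun h => hp0 (hzero p hp h hpq)⟩
  have hne₂ : ∃ p ∈ W, eval p q₂ ≠ 0 := by
    obtain ⟨p, hp, hp0, hpq⟩ := exists_zero_of_isHomogeneous hW two_ne_zero hq₁
    exact ⟨p, hp, fun h => hp0 (hzero p hp hpq h)⟩
  obtain ⟨v, hv, hv₁, hv₂⟩ := exists_eval_ne_zero_and_eval_ne_zero hne₁ hne₂
  obtain ⟨u, hu, huv⟩ := exists_mem_forall_add_smul_ne_zero hW v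
  have hdeg : (lineRestrict u v (q₁ * q₂)).natDegree = 4 :=
    lineRestrict_natDegree_eq u (hq₁.mul hq₂) (by rw [map_mul]; exact mul_ne_zero hv₁ hv₂)
  have hcop : IsCoprime (lineRestrict u v q₁) (lineRestrict u v q₂) := by
    rw [Polynomial.isCoprime_iff_aeval_ne_zero_of_isAlgClosed ℂ ℂ]
    intro t
    simp only [Polynomial.coe_aeval_eq_eval, eval_lineRestrict]
    by_contra! h
    exact huv t (hzero _ (W.add_mem hu (W.smul_mem t hv)) h.1 h.2)
  have hker : Ideal.span {f | f ∈ Ideal.span {l₁, q₁} ⊓ Ideal.span {l₂, q₂} ∧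
      ∃ d ≤ 3, f.IsHomogeneous d} ≤ RingHom.ker (lineRestrict u v) := by
    rw [Ideal.span_le]
    rintro f ⟨⟨hf₁, hf₂⟩, d, hd, hfd⟩
    have hdvd := hcop.mul_dvd (lineRestrict_dvd_of_mem_span_pair hW₁ hu hv hf₁)
      (lineRestrict_dvd_of_mem_span_pair hW₂ hu hv hf₂)
    rw [← map_mul] at hdvd
    have hle := (lineRestrict_natDegree_le_and_coeff u v hfd).1
    exact Polynomial.eq_zero_of_dvd_of_natDegree_lt hdvd (by omega)
  refine lt_of_le_of_ne (Ideal.span_le.mpr fun f hf => hf.1) fun heq => ?_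
  have hmem : q₁ * q₂ ∈ Ideal.span {l₁, q₁} ⊓ Ideal.span {l₂, q₂} :=
    ⟨Ideal.mul_mem_right _ _ (Ideal.subset_span (by simp)),
      Ideal.mul_mem_left _ _ (Ideal.subset_span (by simp))⟩
  have h0 : lineRestrict u v (q₁ * q₂) = 0 := hker (heq.ge hmem)
  simp [h0] at hdeg
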